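/- Let X be a simple graph as in the context, let α = (M + √(M² + 4M))/2, fix vertices x₀ and x, and set f(u) = A_X u − Q_X u². Define Z_X(u, x₀, x) = exp(Σ_{m=1}^{∞} (N_{X,m}(x₀, x)/m) u^m). Then for |u| < 1/α: Z_X(u, x₀, x) = (1−u²)^{−((deg(x₀)−2)/2)·δ_{x₀}(x)} · exp(−[log(I − (D_X − Δ_X)u + (D_X − I)u²)](x₀, x)) · exp(∫₀ᵘ z²·Σ_{n=1}^{∞} (1/n)·Σ_{j=1}^{n−1} j·[f(z)^{n−1−j}[A_X, D_X]f(z)^{j−1}](x₀, x) dz) · exp(Σ_{m=3}^{∞} (R_m(x₀, x)/m) u^m). -/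

import Mathlib

noncomputable section

/-- The Hilbert space `ℓ²(V)` of square-summable complex functions on `V`. -/
abbrev ℓ2 (V : Type) : Type := lp (fun _ : V => ℂ) 2

namespace SimpleGraph

variable {V : Type} (G : SimpleGraph V)

/-- The degree of a vertex. -/
def gdeg (v : V) : ℕ := Nat.card (G.neighborSet v)

/-- A geodesic (non-backtracking) path of length `m` in a simple graph,
encoded as its sequence of `m + 1` vertices. -/
def IsGeoPath {m : ℕ} (p : Fin (m + 1) → V) : Prop :=
  (∀ (i : ℕ) (h : i + 1 < m + 1), G.Adj (p ⟨i, by omega⟩) (p ⟨i + 1, h⟩)) ∧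
  (∀ (i : ℕ) (h : i + 2 < m + 1), p ⟨i + 2, h⟩ ≠ p ⟨i, by omega⟩)

/-- The number of geodesic loops (closed non-backtracking paths) of length `m`
at `x`. -/
def cLoop (m : ℕ) (x : V) : ℕ :=
  Nat.card {p : Fin (m + 1) → V // G.IsGeoPath p ∧ p 0 = x ∧ p (Fin.last m) = x}

/-- The formal combinatorial Laplacian applied to `cLoop m`:
`(Δ_X c_m)(x) = deg(x)·c_m(x) − Σ_{y ∼ x} c_m(y)`. -/
def lapc (m : ℕ) (x : V) : ℤ :=
  (G.gdeg x : ℤ) * G.cLoop m x - ∑ᶠ y ∈ G.neighborSet x, (G.cLoop m y : ℤ)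

/-- The defining property of the geodesic-path-counting operators `C_m` on
`ℓ²(V)`: `(C_m f)(x) = Σ_c f(t(c))`, the sum over all geodesic paths `c` of
length `m` starting at `x` (so `C₀ = I` and `C₁ = A_X`). -/
def IsGeoCountOp (C : ℕ → (ℓ2 V →L[ℂ] ℓ2 V)) : Prop :=
  ∀ (m : ℕ) (f : ℓ2 V) (x : V),
    C m f x =
      ∑ᶠ p : {p : Fin (m + 1) → V // G.IsGeoPath p ∧ p 0 = x}, f (p.1 (Fin.last m))

/-- The defining property of the adjacency operator on `ℓ²(V)`:
`(A f)(x) = Σ_{y ∼ x} f(y)`. -/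
def IsAdjOp (A : ℓ2 V →L[ℂ] ℓ2 V) : Prop :=
  ∀ (f : ℓ2 V) (x : V), A f x = ∑ᶠ y ∈ G.neighborSet x, f y

/-- The defining property of the valency operator on `ℓ²(V)`:
`(D f)(x) = deg(x)·f(x)`. -/
def IsValOp (D : ℓ2 V →L[ℂ] ℓ2 V) : Prop :=
  ∀ (f : ℓ2 V) (x : V), D f x = (G.gdeg x : ℂ) * f x

end SimpleGraph

/-- The `(x₀, x)` matrix entry of a bounded operator on `ℓ²(V)`:
`B(x₀, x) = (B δ_{x₀})(x)`, where `δ_{x₀}` is the Kronecker delta at `x₀`. -/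
def ent {V : Type} [DecidableEq V] (T : ℓ2 V →L[ℂ] ℓ2 V) (x₀ x : V) : ℂ :=
  T (lp.single 2 x₀ 1) x

section QuadraticPencil

variable {𝔄 : Type*} [NormedRing 𝔄] [NormedAlgebra ℂ 𝔄]

/-- The Taylor coefficients of `(1 - z A + z² Q)⁻¹`. -/
def resolventCoeff (A Q : 𝔄) : ℕ → 𝔄
  | 0 => 1
  | 1 => A
  | n + 2 => A * resolventCoeff A Q (n + 1) - Q * resolventCoeff A Q n

/-- The quadratic pencil `z A - z² Q`. -/
def pencil (A Q : 𝔄) (z : ℂ) : 𝔄 := z • A - z ^ 2 • Q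

/-- The derivative `A - 2 z Q` of the quadratic pencil. -/
def pencilDeriv (A Q : 𝔄) (z : ℂ) : 𝔄 := A - (2 * z) • Q

/-- The commutator correction in the derivative of the powers of the pencil. -/
def commutatorSum (A Q : 𝔄) (n : ℕ) (z : ℂ) : 𝔄 :=
  ∑ j ∈ Finset.Icc 1 n,
    (j : ℂ) • (pencil A Q z ^ (n - j) * (A * Q - Q * A) * pencil A Q z ^ (j - 1))

/-- The derivative of `pencil A Q z ^ (n + 1)`. -/
def pencilPowDeriv (A Q : 𝔄) (n : ℕ) (z : ℂ) : 𝔄 :=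
  ((n : ℂ) + 1) • (pencilDeriv A Q z * pencil A Q z ^ n) - z ^ 2 • commutatorSum A Q n z

lemma pencil_mul_pencilDeriv (A Q : 𝔄) (z : ℂ) :
    pencil A Q z * pencilDeriv A Q z =
      pencilDeriv A Q z * pencil A Q z - z ^ 2 • (A * Q - Q * A) := by
  simp only [pencil, pencilDeriv, mul_sub, sub_mul, smul_mul_assoc, mul_smul_comm, smul_smul,
    smul_sub]
  module

lemma commutatorSum_succ (A Q : 𝔄) (n : ℕ) (z : ℂ) :
    commutatorSum A Q (n + 1) z =
      pencil A Q z * commutatorSum A Q n z +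
        ((n : ℂ) + 1) • ((A * Q - Q * A) * pencil A Q z ^ n) := by
  unfold commutatorSum
  rw [Finset.sum_Icc_succ_top (by omega), Finset.mul_sum]
  congr 1
  · refine Finset.sum_congr rfl fun j hj => ?_
    rw [Finset.mem_Icc] at hj
    rw [show n + 1 - j = (n - j) + 1 by omega, pow_succ']
    simp only [mul_smul_comm, mul_assoc]
  · simp

lemma pencilPowDeriv_succ (A Q : 𝔄) (n : ℕ) (z : ℂ) :
    pencilPowDeriv A Q (n + 1) z =
      pencilDeriv A Q z * pencil A Q z ^ (n + 1) + pencil A Q z * pencilPowDeriv A Q n z := by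
  have h : pencil A Q z * (pencilDeriv A Q z * pencil A Q z ^ n) =
      pencilDeriv A Q z * pencil A Q z ^ (n + 1) -
        z ^ 2 • ((A * Q - Q * A) * pencil A Q z ^ n) := by
    rw [← mul_assoc, pencil_mul_pencilDeriv, sub_mul, smul_mul_assoc,
      pow_succ' (pencil A Q z) n, mul_assoc]
  unfold pencilPowDeriv
  rw [commutatorSum_succ, mul_sub, mul_smul_comm, mul_smul_comm, h]
  push_cast
  module

lemma hasDerivAt_pencil (A Q : 𝔄) (z : ℂ) :
    HasDerivAt (pencil A Q) (pencilDeriv A Q z) z := by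
  have h1 := (hasDerivAt_id z).smul_const A
  have h2 := ((hasDerivAt_id z).pow 2).smul_const Q
  have h := h1.sub h2
  refine HasDerivAt.congr_deriv (f := pencil A Q) h ?_
  simp [pencilDeriv]

lemma hasDerivAt_pencil_pow (A Q : 𝔄) (n : ℕ) (z : ℂ) :
    HasDerivAt (fun w => pencil A Q w ^ (n + 1)) (pencilPowDeriv A Q n z) z := by
  induction n with
  | zero =>
    simpa [pencilPowDeriv, commutatorSum] using hasDerivAt_pencil A Q z
  | succ n ih =>
    rw [pencilPowDeriv_succ]
    have h := (hasDerivAt_pencil A Q z).mul ih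
    refine h.congr_of_eventuallyEq (Filter.Eventually.of_forall fun w => ?_)
    simp [pow_succ' _ (n + 1)]

lemma norm_pencil_le {A Q : 𝔄} {M ρ : ℝ} {z : ℂ} (hA : ‖A‖ ≤ M) (hQ : ‖Q‖ ≤ M) (hz : ‖z‖ ≤ ρ) :
    ‖pencil A Q z‖ ≤ M * ρ + M * ρ ^ 2 := by
  have hM : 0 ≤ M := (norm_nonneg A).trans hA
  have hρ : 0 ≤ ρ := (norm_nonneg z).trans hz
  calc ‖pencil A Q z‖ ≤ ‖z • A‖ + ‖z ^ 2 • Q‖ := norm_sub_le _ _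
    _ = ‖z‖ * ‖A‖ + ‖z‖ ^ 2 * ‖Q‖ := by rw [norm_smul, norm_smul, norm_pow]
    _ ≤ ρ * M + ρ ^ 2 * M := by gcongr
    _ = _ := by ring

lemma norm_pencilDeriv_le {A Q : 𝔄} {M ρ : ℝ} {z : ℂ} (hA : ‖A‖ ≤ M) (hQ : ‖Q‖ ≤ M)
    (hz : ‖z‖ ≤ ρ) : ‖pencilDeriv A Q z‖ ≤ M + 2 * ρ * M := by
  have hM : 0 ≤ M := (norm_nonneg A).trans hA
  have hρ : 0 ≤ ρ := (norm_nonneg z).trans hz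
  calc ‖pencilDeriv A Q z‖ ≤ ‖A‖ + ‖(2 * z) • Q‖ := norm_sub_le _ _
    _ = ‖A‖ + 2 * ‖z‖ * ‖Q‖ := by rw [norm_smul, norm_mul]; simp
    _ ≤ _ := by gcongr

lemma quadratic_lt_one {M a r : ℝ} (hM : 0 ≤ M) (ha : a ^ 2 = M * a + M) (ha1 : 1 ≤ a)
    (hr : 0 ≤ r) (hra : r * a < 1) : M * r + M * r ^ 2 < 1 := by
  have h1 : (M * r + M * r ^ 2) * a ^ 2 ≤ (r * a) * a ^ 2 := by
    have h2 : (r * a) ^ 2 ≤ r * a := by nlinarith [mul_nonneg hr (zero_le_one.trans ha1)]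
    calc (M * r + M * r ^ 2) * a ^ 2 = M * a * (r * a) + M * (r * a) ^ 2 := by ring
      _ ≤ M * a * (r * a) + M * (r * a) := by gcongr
      _ = (r * a) * (M * a + M) := by ring
      _ = _ := by rw [ha]
  exact (le_of_mul_le_mul_right h1 (by positivity)).trans_lt hra

variable [NormOneClass 𝔄]

lemma norm_pencilPowDeriv_le (A Q : 𝔄) (n : ℕ) (z : ℂ) :
    ‖pencilPowDeriv A Q n z‖ ≤ ((n : ℝ) + 1) * ‖pencilDeriv A Q z‖ * ‖pencil A Q z‖ ^ n := by
  induction n with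
  | zero => simp [pencilPowDeriv, commutatorSum]
  | succ n ih =>
    rw [pencilPowDeriv_succ]
    calc _ ≤ ‖pencilDeriv A Q z * pencil A Q z ^ (n + 1)‖ +
          ‖pencil A Q z * pencilPowDeriv A Q n z‖ := norm_add_le _ _
      _ ≤ ‖pencilDeriv A Q z‖ * ‖pencil A Q z‖ ^ (n + 1) +
          ‖pencil A Q z‖ * (((n : ℝ) + 1) * ‖pencilDeriv A Q z‖ * ‖pencil A Q z‖ ^ n) := by
        refine add_le_add ((norm_mul_le _ _).trans ?_) ((norm_mul_le _ _).trans ?_)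
        · gcongr
          exact norm_pow_le _ _
        · gcongr
      _ = _ := by push_cast; ring

omit [NormedAlgebra ℂ 𝔄] in
lemma norm_resolventCoeff_le {A Q : 𝔄} {M a : ℝ} (hA : ‖A‖ ≤ M) (hQ : ‖Q‖ ≤ M)
    (ha : a ^ 2 = M * a + M) (hMa : M ≤ a) (n : ℕ) : ‖resolventCoeff A Q n‖ ≤ a ^ n := by
  have hM : 0 ≤ M := (norm_nonneg A).trans hA
  induction n using Nat.twoStepInduction with
  | zero => simp [resolventCoeff]
  | one => simpa [resolventCoeff] using hA.trans hMa
  | more n h0 h1 =>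
    calc ‖resolventCoeff A Q (n + 2)‖
        ≤ ‖A * resolventCoeff A Q (n + 1)‖ + ‖Q * resolventCoeff A Q n‖ := norm_sub_le _ _
      _ ≤ M * a ^ (n + 1) + M * a ^ n := by
        refine add_le_add ((norm_mul_le _ _).trans ?_) ((norm_mul_le _ _).trans ?_) <;> gcongr
      _ = a ^ n * (M * a + M) := by ring
      _ = a ^ (n + 2) := by rw [← ha]; ring

/-- The coefficients of the logarithmic derivative
`(A - 2 z Q) (1 - z A + z² Q)⁻¹ + z (1 - z²)⁻¹ (Q - 1)`. -/
def logDerivCoeff (A Q : 𝔄) : ℕ → 𝔄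
  | 0 => A
  | m + 1 => A * resolventCoeff A Q (m + 1) - (2 : ℂ) • (Q * resolventCoeff A Q m) +
      if Even m then Q - 1 else 0

lemma norm_logDerivCoeff_le {A Q : 𝔄} {M a : ℝ} (hA : ‖A‖ ≤ M) (hQ : ‖Q‖ ≤ M)
    (ha : a ^ 2 = M * a + M) (hMa : M ≤ a) (ha1 : 1 ≤ a) (m : ℕ) :
    ‖logDerivCoeff A Q m‖ ≤ (4 * M + 1) * a ^ m := by
  have hM : 0 ≤ M := (norm_nonneg A).trans hA
  have hP := norm_resolventCoeff_le hA hQ ha hMa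
  cases m with
  | zero => simp [logDerivCoeff]; linarith
  | succ m =>
    have hpow : a ^ m ≤ a ^ (m + 1) := pow_le_pow_right₀ ha1 (by omega)
    have hone : 1 ≤ a ^ (m + 1) := one_le_pow₀ ha1
    have h1 : ‖A * resolventCoeff A Q (m + 1)‖ ≤ M * a ^ (m + 1) :=
      (norm_mul_le _ _).trans (by gcongr; exact hP _)
    have h2 : ‖(2 : ℂ) • (Q * resolventCoeff A Q m)‖ ≤ 2 * (M * a ^ (m + 1)) := by
      rw [norm_smul]
      have : ‖Q * resolventCoeff A Q m‖ ≤ M * a ^ (m + 1) :=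
        (norm_mul_le _ _).trans (by gcongr; exact (hP _).trans hpow)
      simpa using this
    have h3 : ‖(if Even m then Q - 1 else 0 : 𝔄)‖ ≤ (M + 1) * a ^ (m + 1) := by
      have : ‖Q - 1‖ ≤ M + 1 := (norm_sub_le _ _).trans (by rw [norm_one]; linarith)
      split_ifs
      · nlinarith
      · rw [norm_zero]; positivity
    calc _ ≤ ‖A * resolventCoeff A Q (m + 1)‖ + ‖(2 : ℂ) • (Q * resolventCoeff A Q m)‖ +
          ‖(if Even m then Q - 1 else 0 : 𝔄)‖ :=
        (norm_add_le _ _).trans (add_le_add_left (norm_sub_le _ _) _)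
      _ ≤ M * a ^ (m + 1) + 2 * (M * a ^ (m + 1)) + (M + 1) * a ^ (m + 1) := by gcongr
      _ = _ := by ring

lemma hasSum_even_geometric {z : ℂ} (hz : ‖z‖ < 1) :
    HasSum (fun m : ℕ => if Even m then z ^ (m + 1) else 0) (z / (1 - z ^ 2)) := by
  have h2 : ‖z ^ 2‖ < 1 := by rw [norm_pow]; exact pow_lt_one₀ (norm_nonneg _) hz two_ne_zero
  rw [← add_zero (z / (1 - z ^ 2))]
  refine HasSum.even_add_odd (f := fun m : ℕ => if Even m then z ^ (m + 1) else 0) ?_ ?_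
  · have h := (hasSum_geometric_of_norm_lt_one h2).mul_left z
    rw [← div_eq_mul_inv] at h
    refine h.congr_fun fun k => ?_
    simp [pow_succ', pow_mul]
  · simp [hasSum_zero]

variable [CompleteSpace 𝔄]

lemma hasSum_resolventCoeff {A Q : 𝔄} {M a : ℝ} (hA : ‖A‖ ≤ M) (hQ : ‖Q‖ ≤ M)
    (ha : a ^ 2 = M * a + M) (hMa : M ≤ a) (ha1 : 1 ≤ a) {z : ℂ} (hz : ‖z‖ * a < 1) :
    HasSum (fun n => z ^ n • resolventCoeff A Q n) (∑' n : ℕ, pencil A Q z ^ n) := by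
  have hM : 0 ≤ M := (norm_nonneg A).trans hA
  have hf : ‖pencil A Q z‖ < 1 :=
    (norm_pencil_le hA hQ le_rfl).trans_lt (quadratic_lt_one hM ha ha1 (norm_nonneg z) hz)
  have hsum : Summable (fun n => z ^ n • resolventCoeff A Q n) := by
    refine Summable.of_norm_bounded
      (summable_geometric_of_lt_one (by positivity) hz) fun n => ?_
    rw [norm_smul, norm_pow, mul_pow]
    gcongr
    exact norm_resolventCoeff_le hA hQ ha hMa n
  set S := ∑' n, z ^ n • resolventCoeff A Q n with hS
  have e0 : S = 1 + z • A + ∑' n, z ^ (n + 2) • resolventCoeff A Q (n + 2) := by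
    rw [hS, ← hsum.sum_add_tsum_nat_add 2]
    simp [Finset.sum_range_succ, resolventCoeff]
  have e1 : S = 1 + ∑' n, z ^ (n + 1) • resolventCoeff A Q (n + 1) := by
    rw [hS, ← hsum.sum_add_tsum_nat_add 1]
    simp [resolventCoeff]
  have s1 := (summable_nat_add_iff 1).2 hsum
  have e2 : ∑' n, z ^ (n + 2) • resolventCoeff A Q (n + 2) =
      (z • A) * (∑' n, z ^ (n + 1) • resolventCoeff A Q (n + 1)) - (z ^ 2 • Q) * S := by
    rw [hS, ← s1.tsum_mul_left, ← hsum.tsum_mul_left,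
      ← (s1.mul_left _).tsum_sub (hsum.mul_left _)]
    refine tsum_congr fun n => ?_
    simp only [resolventCoeff, smul_mul_assoc, mul_smul_comm, smul_smul, smul_sub]
    ring_nf
  have key : (1 - pencil A Q z) * S = 1 := by
    have e3 : ∑' n, z ^ (n + 1) • resolventCoeff A Q (n + 1) = S - 1 := by
      rw [e1]; abel
    rw [e3] at e2
    rw [e2] at e0
    have : (1 - pencil A Q z) * S = S - (z • A) * S + (z ^ 2 • Q) * S := by
      rw [pencil]; noncomm_ring
    rw [this]
    nth_rewrite 1 [e0]
    noncomm_ring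
  have : S = ∑' n : ℕ, pencil A Q z ^ n := by
    rw [← mul_one (∑' n : ℕ, pencil A Q z ^ n), ← key, ← mul_assoc,
      geom_series_mul_neg _ hf, one_mul]
  rw [← this]
  exact hsum.hasSum

lemma hasSum_logDerivCoeff {A Q : 𝔄} {M a : ℝ} (hA : ‖A‖ ≤ M) (hQ : ‖Q‖ ≤ M)
    (ha : a ^ 2 = M * a + M) (hMa : M ≤ a) (ha1 : 1 ≤ a) {z : ℂ} (hz : ‖z‖ * a < 1) :
    HasSum (fun m => z ^ m • logDerivCoeff A Q m)
      (pencilDeriv A Q z * ∑' n : ℕ, pencil A Q z ^ n + (z / (1 - z ^ 2)) • (Q - 1)) := by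
  have hz1 : ‖z‖ < 1 := lt_of_le_of_lt (le_mul_of_one_le_right (norm_nonneg _) ha1) hz
  have hG := hasSum_resolventCoeff hA hQ ha hMa ha1 hz
  set G := ∑' n : ℕ, pencil A Q z ^ n
  have hG1 : HasSum (fun n => z ^ (n + 1) • resolventCoeff A Q (n + 1)) (G - 1) := by
    have := (hasSum_nat_add_iff' 1).2 hG
    simpa [resolventCoeff] using this
  have h1 := ((hG1.mul_left A).sub (hG.mul_left ((2 * z) • Q))).add
    ((hasSum_even_geometric hz1).smul_const (Q - 1))
  have h2 : HasSum (fun m => z ^ (m + 1) • logDerivCoeff A Q (m + 1))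
      (A * (G - 1) - (2 * z) • Q * G + (z / (1 - z ^ 2)) • (Q - 1)) := by
    refine h1.congr_fun fun m => ?_
    simp only [logDerivCoeff, smul_add, smul_sub, mul_smul_comm, smul_mul_assoc, smul_smul,
      pow_succ]
    split_ifs
    · module
    · rw [smul_zero, zero_smul, zero_smul]
      module
  have h3 := (hasSum_nat_add_iff (f := fun m => z ^ m • logDerivCoeff A Q m) 1).1 h2
  rw [Finset.sum_range_one, pow_zero, one_smul] at h3
  have e : pencilDeriv A Q z * G + (z / (1 - z ^ 2)) • (Q - 1) =
      A * (G - 1) - (2 * z) • Q * G + (z / (1 - z ^ 2)) • (Q - 1) + logDerivCoeff A Q 0 := by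
    simp only [logDerivCoeff, pencilDeriv, mul_sub, sub_mul, mul_one]
    abel
  rwa [e]

lemma hasDerivAt_log_pencil {A Q : 𝔄} {M a : ℝ} (hA : ‖A‖ ≤ M) (hQ : ‖Q‖ ≤ M)
    (ha : a ^ 2 = M * a + M) (ha1 : 1 ≤ a) {z : ℂ} (hz : ‖z‖ * a < 1) :
    Summable (fun n : ℕ => ((n : ℂ) + 1)⁻¹ • pencilPowDeriv A Q n z) ∧
    HasDerivAt (fun w => ∑' n : ℕ, ((n : ℂ) + 1)⁻¹ • pencil A Q w ^ (n + 1))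
      (∑' n : ℕ, ((n : ℂ) + 1)⁻¹ • pencilPowDeriv A Q n z) z := by
  have hM : 0 ≤ M := (norm_nonneg A).trans hA
  have ha0 : 0 < a := by linarith
  obtain ⟨ρ, hzρ, hρ⟩ : ∃ ρ, ‖z‖ < ρ ∧ ρ < 1 / a := exists_between ((lt_div_iff₀ ha0).2 hz)
  have hρa : ρ * a < 1 := (lt_div_iff₀ ha0).1 hρ
  have hρ0 : 0 < ρ := (norm_nonneg z).trans_lt hzρ
  have hq := quadratic_lt_one hM ha ha1 hρ0.le hρa
  have hbound : ∀ (n : ℕ), ∀ w ∈ Metric.ball (0 : ℂ) ρ,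
      ‖((n : ℂ) + 1)⁻¹ • pencilPowDeriv A Q n w‖ ≤
        (M + 2 * ρ * M) * (M * ρ + M * ρ ^ 2) ^ n := by
    intro n w hw
    have hw' : ‖w‖ ≤ ρ := (mem_ball_zero_iff.1 hw).le
    have hn : ‖((n : ℂ) + 1)‖ = (n : ℝ) + 1 := by
      exact_mod_cast Complex.norm_natCast (n + 1)
    rw [norm_smul, norm_inv, hn, inv_mul_le_iff₀ (by positivity), ← mul_assoc]
    refine (norm_pencilPowDeriv_le A Q n w).trans ?_
    gcongr
    · exact norm_pencilDeriv_le hA hQ hw'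
    · exact norm_pencil_le hA hQ hw'
  have hs : Summable fun n : ℕ => (M + 2 * ρ * M) * (M * ρ + M * ρ ^ 2) ^ n :=
    (summable_geometric_of_lt_one (by positivity) hq).mul_left _
  have hzb : z ∈ Metric.ball (0 : ℂ) ρ := mem_ball_zero_iff.2 hzρ
  refine ⟨Summable.of_norm_bounded hs fun n => hbound n z hzb, ?_⟩
  refine hasDerivAt_tsum_of_isPreconnected hs Metric.isOpen_ball
    (convex_ball (0 : ℂ) ρ).isPreconnected (fun n w _ => ?_) hbound
    (Metric.mem_ball_self hρ0) ?_ hzb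
  · exact (hasDerivAt_pencil_pow A Q n w).const_smul ((n : ℂ) + 1)⁻¹
  · simp [pencil, summable_zero]

variable (φ : 𝔄 →L[ℂ] ℂ)

/-- The commutator integrand in the generalized Ihara formula. -/
def commutatorIntegrand (A Q : 𝔄) (φ : 𝔄 →L[ℂ] ℂ) (z : ℂ) : ℂ :=
  z ^ 2 * ∑' n : ℕ, ((n : ℂ) + 1)⁻¹ * φ (commutatorSum A Q n z)

lemma hasDerivAt_apply_log_pencil {A Q : 𝔄} {M a : ℝ} (hA : ‖A‖ ≤ M) (hQ : ‖Q‖ ≤ M)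
    (ha : a ^ 2 = M * a + M) (ha1 : 1 ≤ a) {z : ℂ} (hz : ‖z‖ * a < 1) :
    HasDerivAt (fun w => φ (∑' n : ℕ, ((n : ℂ) + 1)⁻¹ • pencil A Q w ^ (n + 1)))
      (φ (pencilDeriv A Q z * ∑' n : ℕ, pencil A Q z ^ n) - commutatorIntegrand A Q φ z) z := by
  have hM : 0 ≤ M := (norm_nonneg A).trans hA
  have hf : ‖pencil A Q z‖ < 1 :=
    (norm_pencil_le hA hQ le_rfl).trans_lt (quadratic_lt_one hM ha ha1 (norm_nonneg z) hz)
  obtain ⟨hs, hd⟩ := hasDerivAt_log_pencil hA hQ ha ha1 hz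
  have h := φ.hasFDerivAt.comp_hasDerivAt z hd
  refine h.congr_deriv ?_
  have hgs : Summable fun n : ℕ => pencilDeriv A Q z * pencil A Q z ^ n :=
    (summable_geometric_of_norm_lt_one hf).mul_left _
  have hgs' := hgs.mapL φ
  have hs' := hs.mapL φ
  have e : ∀ n : ℕ, z ^ 2 * (((n : ℂ) + 1)⁻¹ * φ (commutatorSum A Q n z)) =
      φ (pencilDeriv A Q z * pencil A Q z ^ n) -
        φ (((n : ℂ) + 1)⁻¹ • pencilPowDeriv A Q n z) := by
    intro n
    have hn : (n : ℂ) + 1 ≠ 0 := Nat.cast_add_one_ne_zero n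
    simp only [pencilPowDeriv, map_smul, map_sub, smul_eq_mul]
    field_simp
    ring
  rw [commutatorIntegrand, ← tsum_mul_left, tsum_congr e, hgs'.tsum_sub hs',
    ← φ.map_tsum hgs, ← φ.map_tsum hs, (summable_geometric_of_norm_lt_one hf).tsum_mul_left]
  ring

lemma hasDerivAt_logDerivCoeff_series {A Q : 𝔄} {M a : ℝ} (hA : ‖A‖ ≤ M) (hQ : ‖Q‖ ≤ M)
    (ha : a ^ 2 = M * a + M) (hMa : M ≤ a) (ha1 : 1 ≤ a) {z : ℂ} (hz : ‖z‖ * a < 1) :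
    HasDerivAt (fun w => ∑' m : ℕ, φ (logDerivCoeff A Q m) / ((m : ℂ) + 1) * w ^ (m + 1))
      (φ (pencilDeriv A Q z * ∑' n : ℕ, pencil A Q z ^ n) +
        z / (1 - z ^ 2) * φ (Q - 1)) z := by
  have hM : 0 ≤ M := (norm_nonneg A).trans hA
  have ha0 : 0 < a := by linarith
  obtain ⟨ρ, hzρ, hρ⟩ : ∃ ρ, ‖z‖ < ρ ∧ ρ < 1 / a := exists_between ((lt_div_iff₀ ha0).2 hz)
  have hρa : ρ * a < 1 := (lt_div_iff₀ ha0).1 hρ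
  have hρ0 : 0 < ρ := (norm_nonneg z).trans_lt hzρ
  have hbound : ∀ (m : ℕ), ∀ w ∈ Metric.ball (0 : ℂ) ρ,
      ‖φ (w ^ m • logDerivCoeff A Q m)‖ ≤ ‖φ‖ * (4 * M + 1) * (ρ * a) ^ m := by
    intro m w hw
    have hw' : ‖w‖ ≤ ρ := (mem_ball_zero_iff.1 hw).le
    calc _ ≤ ‖φ‖ * ‖w ^ m • logDerivCoeff A Q m‖ := φ.le_opNorm _
      _ = ‖φ‖ * (‖w‖ ^ m * ‖logDerivCoeff A Q m‖) := by rw [norm_smul, norm_pow]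
      _ ≤ ‖φ‖ * (ρ ^ m * ((4 * M + 1) * a ^ m)) := by
        gcongr
        exact norm_logDerivCoeff_le hA hQ ha hMa ha1 m
      _ = _ := by rw [mul_pow]; ring
  have hs : Summable fun m : ℕ => ‖φ‖ * (4 * M + 1) * (ρ * a) ^ m :=
    (summable_geometric_of_lt_one (by positivity) hρa).mul_left _
  have hzb : z ∈ Metric.ball (0 : ℂ) ρ := mem_ball_zero_iff.2 hzρ
  have h := hasDerivAt_tsum_of_isPreconnected hs Metric.isOpen_ball
    (convex_ball (0 : ℂ) ρ).isPreconnected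
    (g := fun m w => φ (logDerivCoeff A Q m) / ((m : ℂ) + 1) * w ^ (m + 1))
    (g' := fun m w => φ (w ^ m • logDerivCoeff A Q m)) (fun m w _ => ?_) hbound
    (Metric.mem_ball_self hρ0) (by simp [summable_zero]) hzb
  · have hsum := (hasSum_logDerivCoeff hA hQ ha hMa ha1 hz).mapL φ
    rw [hsum.tsum_eq, map_add, map_smul, smul_eq_mul] at h
    exact h
  · have hm : (m : ℂ) + 1 ≠ 0 := Nat.cast_add_one_ne_zero m
    have h := ((hasDerivAt_id w).pow (m + 1)).const_mul (φ (logDerivCoeff A Q m) / ((m : ℂ) + 1))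
    refine HasDerivAt.congr_deriv
      (f := fun w => φ (logDerivCoeff A Q m) / ((m : ℂ) + 1) * w ^ (m + 1)) h ?_
    simp only [map_smul, smul_eq_mul, id_eq, mul_one, Nat.add_sub_cancel]
    push_cast
    field_simp

omit [CompleteSpace 𝔄] in
lemma summable_logDerivCoeff_series {A Q : 𝔄} {M a : ℝ} (hA : ‖A‖ ≤ M) (hQ : ‖Q‖ ≤ M)
    (ha : a ^ 2 = M * a + M) (hMa : M ≤ a) (ha1 : 1 ≤ a) {z : ℂ} (hz : ‖z‖ * a < 1) :
    Summable (fun m : ℕ => φ (logDerivCoeff A Q m) / ((m : ℂ) + 1) * z ^ (m + 1)) := by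
  have hM : 0 ≤ M := (norm_nonneg A).trans hA
  refine Summable.of_norm_bounded (g := fun m => ‖φ‖ * (4 * M + 1) * ‖z‖ * (‖z‖ * a) ^ m)
    ((summable_geometric_of_lt_one (by positivity) hz).mul_left _) fun m => ?_
  have hn : ‖((m : ℂ) + 1)‖ = (m : ℝ) + 1 := by
    exact_mod_cast Complex.norm_natCast (m + 1)
  have hφ : ‖φ (logDerivCoeff A Q m)‖ ≤ ‖φ‖ * ((4 * M + 1) * a ^ m) :=
    φ.le_opNorm_of_le (norm_logDerivCoeff_le hA hQ ha hMa ha1 m)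
  rw [norm_mul, norm_div, hn, norm_pow]
  calc _ ≤ ‖φ (logDerivCoeff A Q m)‖ * ‖z‖ ^ (m + 1) := by
        gcongr
        exact div_le_self (norm_nonneg _) (by linarith [(Nat.cast_nonneg m : (0 : ℝ) ≤ m)])
    _ ≤ ‖φ‖ * ((4 * M + 1) * a ^ m) * ‖z‖ ^ (m + 1) := by gcongr
    _ = _ := by rw [mul_pow]; ring

lemma hasDerivAt_log_one_sub_sq {z : ℂ} (hz : ‖z‖ < 1) :
    HasDerivAt (fun w : ℂ => Complex.log (1 - w ^ 2)) (-(2 * z) / (1 - z ^ 2)) z := by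
  have hslit : 1 - z ^ 2 ∈ Complex.slitPlane := by
    refine Complex.mem_slitPlane_of_norm_lt_one (z := -z ^ 2) ?_
    rw [norm_neg, norm_pow]
    exact pow_lt_one₀ (norm_nonneg _) hz two_ne_zero
  have h := (((hasDerivAt_id z).pow 2).const_sub 1).clog hslit
  simpa using h

theorem logDerivCoeff_series_eq {A Q : 𝔄} {M a : ℝ} (hA : ‖A‖ ≤ M) (hQ : ‖Q‖ ≤ M)
    (ha : a ^ 2 = M * a + M) (hMa : M ≤ a) (ha1 : 1 ≤ a) {u : ℂ} (hu : ‖u‖ * a < 1) :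
    ∑' m : ℕ, φ (logDerivCoeff A Q m) / ((m : ℂ) + 1) * u ^ (m + 1) =
      Complex.log (1 - u ^ 2) * (-(φ (Q - 1) / 2)) +
        φ (∑' n : ℕ, ((n : ℂ) + 1)⁻¹ • pencil A Q u ^ (n + 1)) +
        ∫ t in (0 : ℝ)..1, u * commutatorIntegrand A Q φ (t * u) := by
  have ha0 : 0 < a := by linarith
  let F : ℂ → ℂ := fun w => ∑' m : ℕ, φ (logDerivCoeff A Q m) / ((m : ℂ) + 1) * w ^ (m + 1) -
    Complex.log (1 - w ^ 2) * (-(φ (Q - 1) / 2)) -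
    φ (∑' n : ℕ, ((n : ℂ) + 1)⁻¹ • pencil A Q w ^ (n + 1))
  have hF : ∀ z : ℂ, ‖z‖ * a < 1 → HasDerivAt F (commutatorIntegrand A Q φ z) z := by
    intro z hz
    have hz1 : ‖z‖ < 1 := lt_of_le_of_lt (le_mul_of_one_le_right (norm_nonneg _) ha1) hz
    have h := ((hasDerivAt_logDerivCoeff_series φ hA hQ ha hMa ha1 hz).sub
      ((hasDerivAt_log_one_sub_sq hz1).mul_const (-(φ (Q - 1) / 2)))).sub
      (hasDerivAt_apply_log_pencil φ hA hQ ha ha1 hz)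
    refine h.congr_deriv ?_
    ring
  have hball : ∀ z ∈ Metric.ball (0 : ℂ) (1 / a), ‖z‖ * a < 1 := fun z hz =>
    (lt_div_iff₀ ha0).1 (mem_ball_zero_iff.1 hz)
  have hcont : ContinuousOn (commutatorIntegrand A Q φ) (Metric.ball (0 : ℂ) (1 / a)) := by
    have hdiff : DifferentiableOn ℂ F (Metric.ball (0 : ℂ) (1 / a)) := fun z hz =>
      (hF z (hball z hz)).differentiableAt.differentiableWithinAt
    refine (hdiff.deriv Metric.isOpen_ball).continuousOn.congr fun z hz => ?_
    exact (hF z (hball z hz)).deriv.symm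
  have hseg : ∀ t ∈ Set.uIcc (0 : ℝ) 1, ‖(t : ℂ) * u‖ * a < 1 := by
    intro t ht
    rw [Set.uIcc_of_le zero_le_one] at ht
    refine lt_of_le_of_lt ?_ hu
    rw [norm_mul, Complex.norm_real, Real.norm_of_nonneg ht.1]
    have := mul_le_of_le_one_left (norm_nonneg u) ht.2
    gcongr
  have hintegral := intervalIntegral.integral_eq_sub_of_hasDerivAt (a := 0) (b := 1)
    (f := fun t : ℝ => F (t * u)) (f' := fun t : ℝ => u * commutatorIntegrand A Q φ (t * u))
    (fun t ht => by
      have h1 : HasDerivAt (fun s : ℂ => s * u) u (t : ℂ) := by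
        simpa using (hasDerivAt_id (t : ℂ)).mul_const u
      have h2 := ((hF _ (hseg t ht)).comp (t : ℂ) h1).comp_ofReal
      rw [mul_comm] at h2
      exact h2)
    (by
      refine ContinuousOn.intervalIntegrable (continuousOn_const.mul
        (hcont.comp (by fun_prop) fun t ht => ?_))
      exact mem_ball_zero_iff.2 ((lt_div_iff₀ ha0).2 (hseg t ht)))
  have hF0 : F 0 = 0 := by simp [F, pencil]
  rw [hintegral]
  simp only [Complex.ofReal_one, one_mul, Complex.ofReal_zero, zero_mul, hF0, sub_zero]
  simp only [F]
  ring

end QuadraticPencil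

section Operators

variable {V : Type}

lemma ℓ2.norm_le_of_forall_sum_sq_le {f : ℓ2 V} {c : ℝ} (hc : 0 ≤ c)
    (h : ∀ s : Finset V, ∑ i ∈ s, ‖f i‖ ^ 2 ≤ c ^ 2) : ‖f‖ ≤ c := by
  refine lp.norm_le_of_forall_sum_le (by simp) hc fun s => ?_
  simpa using h s

lemma ℓ2.sum_sq_le_norm_sq (f : ℓ2 V) (s : Finset V) : ∑ i ∈ s, ‖f i‖ ^ 2 ≤ ‖f‖ ^ 2 := by
  simpa using lp.sum_rpow_le_norm_rpow (p := 2) (by simp) f s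

lemma norm_le_of_isDiagonal {T : ℓ2 V →L[ℂ] ℓ2 V} {d : V → ℂ} {M : ℝ} (hM : 0 ≤ M)
    (hT : ∀ (f : ℓ2 V) (x : V), T f x = d x * f x) (hd : ∀ x, ‖d x‖ ≤ M) : ‖T‖ ≤ M := by
  refine T.opNorm_le_bound hM fun f => ?_
  refine ℓ2.norm_le_of_forall_sum_sq_le (by positivity) fun s => ?_
  calc ∑ i ∈ s, ‖T f i‖ ^ 2 ≤ ∑ i ∈ s, M ^ 2 * ‖f i‖ ^ 2 := by
        refine Finset.sum_le_sum fun i _ => ?_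
        rw [hT, norm_mul, mul_pow]
        gcongr
        exact hd i
    _ = M ^ 2 * ∑ i ∈ s, ‖f i‖ ^ 2 := by rw [Finset.mul_sum]
    _ ≤ M ^ 2 * ‖f‖ ^ 2 := by
        gcongr
        exact ℓ2.sum_sq_le_norm_sq f s
    _ = _ := by ring

variable [DecidableEq V]

/-- The matrix entry `ent · x₀ x` as a continuous linear functional. -/
def entCLM (x₀ x : V) : (ℓ2 V →L[ℂ] ℓ2 V) →L[ℂ] ℂ :=
  (lp.evalCLM ℂ (fun _ : V => ℂ) 2 x).comp
    (ContinuousLinearMap.apply ℂ (ℓ2 V) (lp.single 2 x₀ (1 : ℂ)))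

lemma entCLM_apply (x₀ x : V) (T : ℓ2 V →L[ℂ] ℓ2 V) : entCLM x₀ x T = ent T x₀ x := rfl

lemma norm_ent_le (T : ℓ2 V →L[ℂ] ℓ2 V) (x₀ x : V) : ‖ent T x₀ x‖ ≤ ‖T‖ := by
  calc ‖ent T x₀ x‖ ≤ ‖T (lp.single 2 x₀ 1)‖ := lp.norm_apply_le_norm (by simp) _ _
    _ ≤ ‖T‖ * ‖(lp.single 2 x₀ 1 : ℓ2 V)‖ := T.le_opNorm _
    _ = ‖T‖ := by rw [lp.norm_single (by simp)]; simp

lemma single_apply_eq_ite (x₀ x : V) :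
    (lp.single 2 x₀ 1 : ℓ2 V) x = if x = x₀ then (1 : ℂ) else 0 := by
  rw [lp.single_apply]
  simp [Pi.single_apply]

lemma ent_of_isDiagonal {T : ℓ2 V →L[ℂ] ℓ2 V} {d : V → ℂ}
    (hT : ∀ (f : ℓ2 V) (x : V), T f x = d x * f x) (x₀ x : V) :
    ent T x₀ x = d x₀ * if x = x₀ then 1 else 0 := by
  rw [ent, hT, single_apply_eq_ite]
  split_ifs with h
  · rw [h]
  · simp

lemma ℓ2.nontrivial (x : V) : Nontrivial (ℓ2 V) := by
  refine ⟨lp.single 2 x 1, 0, fun h => ?_⟩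
  have := congrArg (fun f : ℓ2 V => f x) h
  simp at this

end Operators

namespace SimpleGraph

variable {V : Type} {G : SimpleGraph V}

lemma card_toFinset_neighborSet (hfin : ∀ v : V, (G.neighborSet v).Finite) (x : V) :
    (hfin x).toFinset.card = G.gdeg x := by
  rw [gdeg, Nat.card_coe_set_eq, Set.ncard_eq_toFinset_card _ (hfin x)]

lemma IsAdjOp.apply_eq_sum {A : ℓ2 V →L[ℂ] ℓ2 V} (hA : G.IsAdjOp A)
    (hfin : ∀ v : V, (G.neighborSet v).Finite) (f : ℓ2 V) (x : V) :
    A f x = ∑ y ∈ (hfin x).toFinset, f y := by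
  rw [hA, finsum_mem_eq_finite_toFinset_sum _ (hfin x)]

/-- Schur's test for the adjacency operator. -/
lemma IsAdjOp.norm_le {A : ℓ2 V →L[ℂ] ℓ2 V} (hA : G.IsAdjOp A)
    (hfin : ∀ v : V, (G.neighborSet v).Finite) {M : ℕ} (hM : ∀ v, G.gdeg v ≤ M) :
    ‖A‖ ≤ M := by
  classical
  refine A.opNorm_le_bound (Nat.cast_nonneg M) fun f => ?_
  refine ℓ2.norm_le_of_forall_sum_sq_le (by positivity) fun s => ?_
  have hcard : ∀ v, (hfin v).toFinset.card ≤ M := fun v => by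
    rw [card_toFinset_neighborSet]; exact hM v
  set t : Finset V := s.biUnion fun x => (hfin x).toFinset with ht
  calc ∑ x ∈ s, ‖A f x‖ ^ 2 ≤ ∑ x ∈ s, (M : ℝ) * ∑ y ∈ (hfin x).toFinset, ‖f y‖ ^ 2 := by
        refine Finset.sum_le_sum fun x _ => ?_
        rw [hA.apply_eq_sum hfin]
        calc ‖∑ y ∈ (hfin x).toFinset, f y‖ ^ 2
            ≤ (∑ y ∈ (hfin x).toFinset, ‖f y‖) ^ 2 := by gcongr; exact norm_sum_le _ _
          _ ≤ (hfin x).toFinset.card * ∑ y ∈ (hfin x).toFinset, ‖f y‖ ^ 2 :=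
            sq_sum_le_card_mul_sum_sq
          _ ≤ _ := by gcongr; exact hcard x
    _ = M * ∑ x ∈ s, ∑ y ∈ (hfin x).toFinset, ‖f y‖ ^ 2 := by rw [Finset.mul_sum]
    _ = M * ∑ y ∈ t, ∑ x ∈ s with x ∈ (hfin y).toFinset, ‖f y‖ ^ 2 := by
        congr 1
        refine Finset.sum_comm' fun x y => ?_
        simp only [Set.Finite.mem_toFinset, mem_neighborSet, Finset.mem_filter, ht,
          Finset.mem_biUnion]
        exact ⟨fun h => ⟨⟨h.1, h.2.symm⟩, x, h⟩, fun h => ⟨h.1.1, h.1.2.symm⟩⟩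
    _ ≤ M * ∑ y ∈ t, (M : ℝ) * ‖f y‖ ^ 2 := by
        gcongr with y _
        rw [Finset.sum_const, nsmul_eq_mul]
        gcongr
        refine le_trans ?_ (hcard y)
        exact Finset.card_le_card fun x hx => (Finset.mem_filter.1 hx).2
    _ = M ^ 2 * ∑ y ∈ t, ‖f y‖ ^ 2 := by rw [← Finset.mul_sum]; ring
    _ ≤ M ^ 2 * ‖f‖ ^ 2 := by
        gcongr
        exact ℓ2.sum_sq_le_norm_sq f t
    _ = _ := by ring

variable (G) in
/-- The geodesic paths of length `m + 1` whose first two vertices are `x` and `y`. -/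
def geoPaths (m : ℕ) (x y : V) : Set (Fin (m + 2) → V) :=
  {p | G.IsGeoPath p ∧ p 0 = x ∧ p ⟨1, by omega⟩ = y}

lemma isGeoPath_cons {m : ℕ} {x : V} {p : Fin (m + 2) → V} :
    G.IsGeoPath (Fin.cons x p : Fin (m + 3) → V) ↔
      G.Adj x (p 0) ∧ p ⟨1, by omega⟩ ≠ x ∧ G.IsGeoPath p := by
  constructor
  · rintro ⟨h1, h2⟩
    have hlt1 : 0 + 1 < m + 2 + 1 := by omega
    have hlt2 : 0 + 2 < m + 2 + 1 := by omega
    have a : G.Adj x (p 0) := h1 0 hlt1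
    have b : p ⟨1, by omega⟩ ≠ x := h2 0 hlt2
    exact ⟨a, b, fun i hi => h1 (i + 1) (by omega), fun i hi => h2 (i + 1) (by omega)⟩
  · rintro ⟨h1, h2, h3, h4⟩
    refine ⟨fun i hi => ?_, fun i hi => ?_⟩
    · cases i with
      | zero => exact h1
      | succ i => exact h3 i (by omega)
    · cases i with
      | zero => exact h2
      | succ i => exact h4 i (by omega)

lemma geoPaths_zero {x y : V} (h : G.Adj x y) : G.geoPaths 0 x y = {![x, y]} := by
  ext p
  simp only [geoPaths, Set.mem_ofPred_eq, Set.mem_singleton_iff]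
  constructor
  · rintro ⟨-, h0, h1⟩
    ext i
    fin_cases i
    · exact h0
    · exact h1
  · rintro rfl
    refine ⟨⟨fun i hi => ?_, fun i hi => by omega⟩, rfl, rfl⟩
    obtain rfl : i = 0 := by omega
    exact h

lemma geoPaths_succ {m : ℕ} {x y : V} (h : G.Adj x y) :
    G.geoPaths (m + 1) x y =
      ⋃ w ∈ G.neighborSet y \ {x},
        (fun q : Fin (m + 2) → V => (Fin.cons x q : Fin (m + 3) → V)) '' G.geoPaths m y w := by
  ext p
  simp only [Set.mem_iUnion, Set.mem_image, exists_prop, Set.mem_sdiff, mem_neighborSet,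
    Set.mem_singleton_iff]
  constructor
  · rintro ⟨hp, h0, h1⟩
    have hcons : p = Fin.cons x (Fin.tail p) := by rw [← h0, Fin.cons_self_tail]
    have hp' := hp
    rw [hcons, isGeoPath_cons] at hp'
    refine ⟨p ⟨2, by omega⟩, ⟨?_, ?_⟩, Fin.tail p, ⟨hp'.2.2, h1, rfl⟩, hcons.symm⟩
    · rw [← h1]
      exact hp.1 1 (by omega)
    · exact hp'.2.1
  · rintro ⟨w, ⟨hw, hwx⟩, q, ⟨hq, hq0, hq1⟩, rfl⟩
    refine ⟨isGeoPath_cons.2 ⟨?_, ?_, hq⟩, rfl, hq0⟩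
    · rwa [hq0]
    · rwa [hq1]

lemma cons_image_geoPaths_pairwiseDisjoint (m : ℕ) (x y : V) (s : Set V) :
    s.PairwiseDisjoint fun w =>
      (fun q : Fin (m + 2) → V => (Fin.cons x q : Fin (m + 3) → V)) '' G.geoPaths m y w := by
  intro w _ w' _ hne
  refine Set.disjoint_left.2 ?_
  rintro _ ⟨q, ⟨-, -, hq⟩, rfl⟩ ⟨q', ⟨-, -, hq'⟩, he⟩
  rw [(Fin.cons_right_injective (α := fun _ => V) x) he] at hq'
  exact hne (hq.symm.trans hq')

lemma geoPaths_finite (hfin : ∀ v : V, (G.neighborSet v).Finite) (m : ℕ) {x y : V}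
    (h : G.Adj x y) : (G.geoPaths m x y).Finite := by
  induction m generalizing x y with
  | zero => rw [geoPaths_zero h]; exact Set.finite_singleton _
  | succ m ih =>
    rw [geoPaths_succ h]
    exact ((hfin y).subset Set.sdiff_subset).biUnion fun w hw => (ih hw.1).image _

lemma setOf_isGeoPath_succ (m : ℕ) (x : V) :
    {p : Fin (m + 2) → V | G.IsGeoPath p ∧ p 0 = x} =
      ⋃ y ∈ G.neighborSet x, G.geoPaths m x y := by
  ext p
  simp only [Set.mem_iUnion, geoPaths, Set.mem_ofPred_eq, exists_prop, mem_neighborSet]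
  constructor
  · rintro ⟨hp, h0⟩
    refine ⟨p ⟨1, by omega⟩, ?_, hp, h0, rfl⟩
    rw [← h0]
    exact hp.1 0 (by omega)
  · rintro ⟨y, -, hp, h0, -⟩
    exact ⟨hp, h0⟩

lemma setOf_isGeoPath_zero (x : V) :
    {p : Fin 1 → V | G.IsGeoPath p ∧ p 0 = x} = {fun _ => x} := by
  ext p
  simp only [Set.mem_ofPred_eq, Set.mem_singleton_iff]
  constructor
  · rintro ⟨-, h0⟩
    ext i
    rw [Subsingleton.elim i 0, h0]
  · rintro rfl
    exact ⟨⟨fun i hi => by omega, fun i hi => by omega⟩, rfl⟩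

lemma setOf_isGeoPath_finite (hfin : ∀ v : V, (G.neighborSet v).Finite) (m : ℕ) (x : V) :
    {p : Fin (m + 1) → V | G.IsGeoPath p ∧ p 0 = x}.Finite := by
  cases m with
  | zero => rw [setOf_isGeoPath_zero]; exact Set.finite_singleton _
  | succ m =>
    rw [setOf_isGeoPath_succ]
    exact (hfin x).biUnion fun y hy => geoPaths_finite hfin m hy

variable (G) in
/-- The sum of `f` over the endpoints of the paths in `geoPaths m x y`. -/
def geoSum (f : V → ℂ) (m : ℕ) (x y : V) : ℂ :=
  ∑ᶠ p ∈ G.geoPaths m x y, f (p (Fin.last (m + 1)))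

lemma geoSum_zero (f : V → ℂ) {x y : V} (h : G.Adj x y) : G.geoSum f 0 x y = f y := by
  rw [geoSum, geoPaths_zero h, finsum_mem_singleton]
  rfl

lemma geoSum_succ [DecidableEq V] (hfin : ∀ v : V, (G.neighborSet v).Finite) (f : V → ℂ) (m : ℕ)
    {x y : V} (h : G.Adj x y) :
    G.geoSum f (m + 1) x y = ∑ w ∈ (hfin y).toFinset.erase x, G.geoSum f m y w := by
  have hs : (G.neighborSet y \ {x}).Finite := (hfin y).subset Set.sdiff_subset
  rw [geoSum, geoPaths_succ h,
    finsum_mem_biUnion (cons_image_geoPaths_pairwiseDisjoint m x y _) hs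
      fun w hw => (geoPaths_finite hfin m hw.1).image _,
    finsum_mem_eq_finite_toFinset_sum _ hs]
  refine Finset.sum_congr ?_ fun w _ => ?_
  · ext w
    simp [and_comm]
  · rw [finsum_mem_image (Fin.cons_right_injective (α := fun _ => V) x).injOn]
    rfl

variable {C : ℕ → (ℓ2 V →L[ℂ] ℓ2 V)}

lemma IsGeoCountOp.apply_zero (hC : G.IsGeoCountOp C) (f : ℓ2 V) (x : V) : C 0 f x = f x := by
  rw [hC]
  have h := finsum_set_coe_eq_finsum_mem (f := fun p : Fin 1 → V => f (p (Fin.last 0)))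
    {p : Fin 1 → V | G.IsGeoPath p ∧ p 0 = x}
  rw [setOf_isGeoPath_zero x, finsum_mem_singleton, ← setOf_isGeoPath_zero (G := G) x] at h
  exact h

lemma IsGeoCountOp.apply_succ (hC : G.IsGeoCountOp C)
    (hfin : ∀ v : V, (G.neighborSet v).Finite) (m : ℕ) (f : ℓ2 V) (x : V) :
    C (m + 1) f x = ∑ y ∈ (hfin x).toFinset, G.geoSum f m x y := by
  rw [hC]
  have h := finsum_set_coe_eq_finsum_mem
    (f := fun p : Fin (m + 2) → V => f (p (Fin.last (m + 1))))
    {p : Fin (m + 2) → V | G.IsGeoPath p ∧ p 0 = x}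
  refine h.trans ?_
  rw [setOf_isGeoPath_succ, finsum_mem_biUnion ?_ (hfin x) fun y hy => geoPaths_finite hfin m hy,
    finsum_mem_eq_finite_toFinset_sum _ (hfin x)]
  · rfl
  · intro y _ y' _ hne
    refine Set.disjoint_left.2 ?_
    rintro p ⟨-, -, hp⟩ ⟨-, -, hp'⟩
    exact hne (hp.symm.trans hp')

variable {A D : ℓ2 V →L[ℂ] ℓ2 V}

lemma IsGeoCountOp.zero_eq (hC : G.IsGeoCountOp C) : C 0 = 1 := by
  ext f x
  exact hC.apply_zero f x

lemma IsGeoCountOp.one_eq (hC : G.IsGeoCountOp C) (hA : G.IsAdjOp A)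
    (hfin : ∀ v : V, (G.neighborSet v).Finite) : C 1 = A := by
  ext f x
  rw [hC.apply_succ hfin, hA.apply_eq_sum hfin]
  refine Finset.sum_congr rfl fun y hy => geoSum_zero _ ?_
  simpa using hy

lemma IsGeoCountOp.adj_mul_one (hC : G.IsGeoCountOp C) (hA : G.IsAdjOp A) (hD : G.IsValOp D)
    (hfin : ∀ v : V, (G.neighborSet v).Finite) : A * A = C 2 + D := by
  classical
  ext f x
  change A (A f) x = C 2 f x + D f x
  rw [hC.apply_succ hfin, hA.apply_eq_sum hfin, hD, ← card_toFinset_neighborSet hfin,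
    ← nsmul_eq_mul, ← Finset.sum_const, ← Finset.sum_add_distrib]
  refine Finset.sum_congr rfl fun y hy => ?_
  have hxy : G.Adj x y := by simpa using hy
  rw [hA.apply_eq_sum hfin, geoSum_succ hfin _ _ hxy,
    ← Finset.sum_erase_add _ _ (show x ∈ (hfin y).toFinset by simpa using hxy.symm)]
  congr 1
  refine Finset.sum_congr rfl fun w hw => (geoSum_zero _ ?_).symm
  simpa using (Finset.mem_erase.1 hw).2

lemma IsGeoCountOp.adj_mul (hC : G.IsGeoCountOp C) (hA : G.IsAdjOp A) (hD : G.IsValOp D)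
    (hfin : ∀ v : V, (G.neighborSet v).Finite) (m : ℕ) :
    A * C (m + 2) = C (m + 3) + (D - 1) * C (m + 1) := by
  classical
  ext f x
  change A (C (m + 2) f) x = C (m + 3) f x + (D (C (m + 1) f) x - C (m + 1) f x)
  have h1 : ∀ y ∈ (hfin x).toFinset, C (m + 2) f y =
      G.geoSum f (m + 2) x y + (C (m + 1) f x - G.geoSum f m x y) := by
    intro y hy
    have hxy : G.Adj x y := by simpa using hy
    rw [hC.apply_succ hfin, hC.apply_succ hfin, geoSum_succ hfin _ _ hxy,
      ← Finset.sum_erase_add _ _ (show x ∈ (hfin y).toFinset by simpa using hxy.symm),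
      geoSum_succ hfin _ _ hxy.symm, ← Finset.sum_erase_add _ _ hy, add_sub_cancel_right]
  rw [hA.apply_eq_sum hfin, Finset.sum_congr rfl h1, Finset.sum_add_distrib,
    Finset.sum_sub_distrib, Finset.sum_const, nsmul_eq_mul, card_toFinset_neighborSet,
    ← hC.apply_succ hfin, ← hC.apply_succ hfin, hD]

lemma IsGeoCountOp.eq_resolventCoeff_sub (hC : G.IsGeoCountOp C) (hA : G.IsAdjOp A)
    (hD : G.IsValOp D) (hfin : ∀ v : V, (G.neighborSet v).Finite) (m : ℕ) :
    C (m + 2) = resolventCoeff A (D - 1) (m + 2) - resolventCoeff A (D - 1) m := by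
  have h2 : C 2 = A * A - D := by rw [hC.adj_mul_one hA hD hfin]; abel
  have hrec : ∀ m, C (m + 3) = A * C (m + 2) - (D - 1) * C (m + 1) := fun m => by
    rw [hC.adj_mul hA hD hfin]; abel
  induction m using Nat.twoStepInduction with
  | zero =>
    simp only [resolventCoeff, h2]
    noncomm_ring
  | one =>
    rw [hrec 0, h2, hC.one_eq hA hfin]
    simp only [resolventCoeff]
    noncomm_ring
  | more m h0 h1 =>
    rw [hrec (m + 1), h1, h0]
    simp only [resolventCoeff]
    noncomm_ring

lemma sum_Icc_one_eq_sum_range {E : Type*} [AddCommMonoid E] (g : ℕ → E) (n : ℕ) :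
    ∑ j ∈ Finset.Icc 1 n, g j = ∑ i ∈ Finset.range n, g (i + 1) := by
  induction n with
  | zero => simp
  | succ n ih => rw [Finset.sum_Icc_succ_top (by omega), ih, Finset.sum_range_succ]

lemma IsGeoCountOp.sum_eq_resolventCoeff (hC : G.IsGeoCountOp C) (hA : G.IsAdjOp A)
    (hD : G.IsValOp D) (hfin : ∀ v : V, (G.neighborSet v).Finite) (k : ℕ) :
    ∑ j ∈ Finset.Icc 1 ((k + 2) / 2), C (k + 2 - 2 * j) = resolventCoeff A (D - 1) k := by
  induction k using Nat.twoStepInduction with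
  | zero => simp [resolventCoeff, hC.zero_eq]
  | one => simp [resolventCoeff, hC.one_eq hA hfin]
  | more k h0 _ =>
    rw [show (k + 2 + 2) / 2 = (k + 2) / 2 + 1 by omega, sum_Icc_one_eq_sum_range,
      Finset.sum_range_succ', sub_eq_iff_eq_add'.1 (hC.eq_resolventCoeff_sub hA hD hfin k).symm,
      ← h0, sum_Icc_one_eq_sum_range]
    refine congrArg₂ (· + ·) (Finset.sum_congr rfl fun i _ => congrArg C ?_) rfl
    omega

lemma IsGeoCountOp.norm_le [Nontrivial (ℓ2 V)] (hC : G.IsGeoCountOp C) (hA : G.IsAdjOp A)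
    (hD : G.IsValOp D) (hfin : ∀ v : V, (G.neighborSet v).Finite) {M a : ℝ} (hAM : ‖A‖ ≤ M)
    (hQM : ‖D - 1‖ ≤ M) (ha : a ^ 2 = M * a + M) (hMa : M ≤ a) (ha1 : 1 ≤ a) (m : ℕ) :
    ‖C m‖ ≤ 2 * a ^ m := by
  match m with
  | 0 => simp [hC.zero_eq]
  | 1 => rw [hC.one_eq hA hfin]; linarith
  | m + 2 =>
    have hP := norm_resolventCoeff_le hAM hQM ha hMa
    have hpow : a ^ m ≤ a ^ (m + 2) := pow_le_pow_right₀ ha1 (by omega)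
    rw [hC.eq_resolventCoeff_sub hA hD hfin]
    linarith [norm_sub_le (resolventCoeff A (D - 1) (m + 2)) (resolventCoeff A (D - 1) m),
      hP (m + 2), hP m]

lemma IsGeoCountOp.ent_eq_cLoop [DecidableEq V] (hC : G.IsGeoCountOp C)
    (hfin : ∀ v : V, (G.neighborSet v).Finite) (m : ℕ) (x : V) :
    ent (C m) x x = G.cLoop m x := by
  rw [ent, hC]
  have := (setOf_isGeoPath_finite hfin m x).fintype
  have : Fintype {p : Fin (m + 1) → V // G.IsGeoPath p ∧ p 0 = x} := this
  rw [finsum_eq_sum_of_fintype, cLoop]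
  simp only [single_apply_eq_ite]
  rw [Finset.sum_boole, ← Fintype.card_subtype, ← Nat.card_eq_fintype_card]
  congr 1
  refine Nat.card_congr ((Equiv.subtypeSubtypeEquivSubtypeInter
    (fun p : Fin (m + 1) → V => G.IsGeoPath p ∧ p 0 = x) fun p => p (Fin.last m) = x).trans
    (Equiv.subtypeEquivRight fun p => and_assoc))

lemma abs_lapc_le {M : ℕ} {b : ℝ} (hfin : ∀ v : V, (G.neighborSet v).Finite)
    (hM : ∀ v, G.gdeg v ≤ M) {m : ℕ} (hb : ∀ x, (G.cLoop m x : ℝ) ≤ b) (x : V) :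
    |(G.lapc m x : ℝ)| ≤ 2 * M * b := by
  have hb0 : 0 ≤ b := (Nat.cast_nonneg _).trans (hb x)
  have hMx : (G.gdeg x : ℝ) ≤ M := by exact_mod_cast hM x
  rw [lapc, finsum_mem_eq_finite_toFinset_sum _ (hfin x)]
  push_cast
  have h1 : (G.gdeg x : ℝ) * G.cLoop m x ≤ M * b := by
    gcongr
    exact hb x
  have h2 : ∑ y ∈ (hfin x).toFinset, (G.cLoop m y : ℝ) ≤ M * b := by
    refine (Finset.sum_le_card_nsmul _ _ b fun y _ => hb y).trans ?_
    rw [card_toFinset_neighborSet, nsmul_eq_mul]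
    gcongr
  have h3 : 0 ≤ (G.gdeg x : ℝ) * G.cLoop m x := by positivity
  have h4 : 0 ≤ ∑ y ∈ (hfin x).toFinset, (G.cLoop m y : ℝ) := by positivity
  rw [abs_le]
  constructor <;> linarith

lemma norm_sum_mul_lapc_le {M : ℕ} {a : ℝ} (hfin : ∀ v : V, (G.neighborSet v).Finite)
    (hM : ∀ v, G.gdeg v ≤ M) (ha1 : 1 ≤ a)
    (hb : ∀ m x, (G.cLoop m x : ℝ) ≤ 2 * a ^ m) (m : ℕ) (x : V) :
    ‖∑ j ∈ Finset.Icc 1 ((m + 1) / 2 - 1), (j : ℂ) * (G.lapc (m - 2 * j) x : ℂ)‖ ≤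
      4 * M * ((m : ℝ) ^ 2 * a ^ m) := by
  have hterm : ∀ j ∈ Finset.Icc 1 ((m + 1) / 2 - 1),
      ‖(j : ℂ) * (G.lapc (m - 2 * j) x : ℂ)‖ ≤ m * (4 * M * a ^ m) := by
    intro j hj
    rw [Finset.mem_Icc] at hj
    have hjm : (j : ℝ) ≤ m := by exact_mod_cast (by omega : j ≤ m)
    have hpow : a ^ (m - 2 * j) ≤ a ^ m := pow_le_pow_right₀ ha1 (by omega)
    have hl := abs_lapc_le hfin hM (hb (m - 2 * j)) x
    rw [norm_mul, Complex.norm_natCast, Complex.norm_intCast]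
    gcongr
    calc _ ≤ 2 * M * (2 * a ^ (m - 2 * j)) := hl
      _ ≤ 2 * M * (2 * a ^ m) := by gcongr
      _ = _ := by ring
  refine (norm_sum_le_of_le _ hterm).trans ?_
  rw [Finset.sum_const, nsmul_eq_mul, Nat.card_Icc]
  have hc : (((m + 1) / 2 - 1 + 1 - 1 : ℕ) : ℝ) ≤ m := by
    exact_mod_cast (by omega : (m + 1) / 2 - 1 + 1 - 1 ≤ m)
  calc _ ≤ (m : ℝ) * (m * (4 * M * a ^ m)) := by gcongr
    _ = _ := by ring

end SimpleGraph

lemma summable_sq_mul_geometric_div {b : ℕ → ℂ} {K a : ℝ} {u : ℂ} (ha : 0 ≤ a)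
    (hu : ‖u‖ * a < 1) (hb : ∀ m, ‖b m‖ ≤ K * ((m : ℝ) ^ 2 * a ^ m)) :
    Summable fun m : ℕ => b (m + 1) / ((m : ℂ) + 1) * u ^ (m + 1) := by
  have hs : Summable fun m : ℕ => (m : ℝ) ^ 2 * (‖u‖ * a) ^ m :=
    summable_pow_mul_geometric_of_norm_lt_one 2
      (by rwa [Real.norm_of_nonneg (by positivity)])
  refine Summable.of_norm_bounded (((summable_nat_add_iff 1).2 hs).mul_left K) fun m => ?_
  have hn : ‖((m : ℂ) + 1)‖ = (m : ℝ) + 1 := by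
    exact_mod_cast Complex.norm_natCast (m + 1)
  rw [norm_mul, norm_div, hn, norm_pow]
  calc _ ≤ ‖b (m + 1)‖ * ‖u‖ ^ (m + 1) := by
        gcongr
        exact div_le_self (norm_nonneg _) (by linarith [(Nat.cast_nonneg m : (0 : ℝ) ≤ m)])
    _ ≤ K * (((m + 1 : ℕ) : ℝ) ^ 2 * a ^ (m + 1)) * ‖u‖ ^ (m + 1) := by
        gcongr
        exact hb (m + 1)
    _ = _ := by rw [mul_pow]; ring

lemma ihara_radius {M a : ℝ} (hM : 1 ≤ M) (ha : a = (M + Real.sqrt (M ^ 2 + 4 * M)) / 2) :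
    a ^ 2 = M * a + M ∧ M ≤ a := by
  have hs := Real.sq_sqrt (show 0 ≤ M ^ 2 + 4 * M by positivity)
  have hM' : M ≤ Real.sqrt (M ^ 2 + 4 * M) := Real.le_sqrt_of_sq_le (by linarith)
  subst ha
  constructor
  · linear_combination hs / 4
  · linarith

/-- Theorem 4.4 of the paper (generalized Ihara zeta formula): for `|u| < 1/α`,

`Z_X(u,x₀,x) = (1−u²)^{−((deg x₀ −2)/2)·δ_{x₀}(x)}
 · exp(−[log(I − (D_X − Δ_X)u + (D_X − I)u²)](x₀,x))
 · exp(∫₀ᵘ z² Σ_{n≥1} (1/n) Σ_{j=1}^{n−1} j·[f(z)^{n−1−j}[A_X,D_X]f(z)^{j−1}](x₀,x) dz)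
 · exp(Σ_{m≥3} R_m(x₀,x)/m · u^m)`,

where `Z_X(u,x₀,x) = exp(Σ_{m≥1} N_{X,m}(x₀,x)/m · u^m)`, `Δ_X = D_X − A_X`,
`f(z) = A_X z − Q_X z²`, `log(I − T) = −Σ_{n≥1} Tⁿ/n`, and the integral is
along the segment from `0` to `u`, parametrized by `z = tu`, `t ∈ [0,1]`. -/
theorem generalized_Ihara_formula {V : Type} [DecidableEq V]
    (G : SimpleGraph V) [Countable V]
    (hconn : G.Connected)
    (hfin : ∀ v : V, (G.neighborSet v).Finite)
    (hbd : ∃ M₀ : ℕ, ∀ v : V, G.gdeg v ≤ M₀)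
    (hdeg1 : ∀ v : V, G.gdeg v ≠ 1)
    (M : ℕ) (hM : M = sSup (Set.range fun v : V => G.gdeg v))
    (A D : ℓ2 V →L[ℂ] ℓ2 V) (hA : G.IsAdjOp A) (hD : G.IsValOp D)
    (C : ℕ → (ℓ2 V →L[ℂ] ℓ2 V)) (hC : G.IsGeoCountOp C)
    (B : ℕ → (ℓ2 V →L[ℂ] ℓ2 V))
    (hB_small : ∀ m : ℕ, m ≤ 2 → B m = C m)
    (hB : ∀ m : ℕ, 3 ≤ m →
      B m = C m - ((D - 1) - 1) * ∑ j ∈ Finset.Icc 1 (m / 2), C (m - 2 * j))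
    (R : ℕ → (ℓ2 V →L[ℂ] ℓ2 V))
    (hR_small : ∀ m : ℕ, m ≤ 2 → R m = 0)
    (hR : ∀ m : ℕ, 3 ≤ m → ∀ (f : ℓ2 V) (x : V),
      R m f x =
        (∑ j ∈ Finset.Icc 1 ((m + 1) / 2 - 1), (j : ℂ) * (G.lapc (m - 2 * j) x : ℂ)) * f x)
    (Rp : ℕ → (ℓ2 V →L[ℂ] ℓ2 V))
    (hRp_small : ∀ m : ℕ, m ≤ 2 → Rp m = 0)
    (hRp : ∀ m : ℕ, 3 ≤ m →
      Rp m = (if Even m then ((D - 1) - 1) else 0) + R m)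
    (NX : ℕ → (ℓ2 V →L[ℂ] ℓ2 V)) (hNX : ∀ m : ℕ, NX m = B m + Rp m)
    (x₀ x : V)
    (u : ℂ) (hu : ‖u‖ < 1 / (((M : ℝ) + Real.sqrt ((M : ℝ) ^ 2 + 4 * M)) / 2)) :
    Complex.exp (∑' m : ℕ, ent (NX (m + 1)) x₀ x / ((m : ℂ) + 1) * u ^ (m + 1)) =
      (1 - u ^ 2) ^ (-(((G.gdeg x₀ : ℂ) - 2) / 2) * (if x = x₀ then (1 : ℂ) else 0)) *
        Complex.exp
          (-(ent (-(∑' n : ℕ, ((n : ℂ) + 1)⁻¹ •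
              (u • (D - (D - A)) - u ^ 2 • (D - 1)) ^ (n + 1))) x₀ x)) *
        Complex.exp
          (∫ t in (0 : ℝ)..(1 : ℝ), u *
            (((t : ℂ) * u) ^ 2 *
              ∑' n : ℕ, ((n : ℂ) + 1)⁻¹ *
                ∑ j ∈ Finset.Icc 1 n, (j : ℂ) *
                  ent ((((t : ℂ) * u) • A - ((t : ℂ) * u) ^ 2 • (D - 1)) ^ (n - j) *
                      (A * D - D * A) *
                      (((t : ℂ) * u) • A - ((t : ℂ) * u) ^ 2 • (D - 1)) ^ (j - 1))
                    x₀ x)) *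
        Complex.exp (∑' m : ℕ, ent (R (m + 3)) x₀ x / ((m : ℂ) + 3) * u ^ (m + 3)) := by
  have hMle : ∀ v, G.gdeg v ≤ M := by
    obtain ⟨M₀, hM₀⟩ := hbd
    intro v
    rw [hM]
    exact le_csSup ⟨M₀, by rintro _ ⟨v, rfl⟩; exact hM₀ v⟩ ⟨v, rfl⟩
  have hM1 : 1 ≤ M := by
    by_contra! h
    obtain rfl : M = 0 := by omega
    have := (norm_nonneg u).trans_lt hu
    simp at this
  have hM1' : (1 : ℝ) ≤ M := by exact_mod_cast hM1
  obtain ⟨a, ha_def⟩ : ∃ a, a = ((M : ℝ) + Real.sqrt ((M : ℝ) ^ 2 + 4 * M)) / 2 := ⟨_, rfl⟩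
  rw [← ha_def] at hu
  obtain ⟨ha, hMa⟩ := ihara_radius hM1' ha_def
  have ha1 : 1 ≤ a := hM1'.trans hMa
  have hua : ‖u‖ * a < 1 := (lt_div_iff₀ (by linarith)).1 hu
  have hu1 : ‖u‖ < 1 := lt_of_le_of_lt (le_mul_of_one_le_right (norm_nonneg _) ha1) hua
  have : Nontrivial (ℓ2 V) := ℓ2.nontrivial x₀
  have hAM : ‖A‖ ≤ M := hA.norm_le hfin hMle
  have hQM : ‖D - 1‖ ≤ M := by
    refine norm_le_of_isDiagonal (d := fun v => (G.gdeg v : ℂ) - 1) (by positivity)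
      (fun f v => ?_) fun v => ?_
    · change D f v - f v = _
      rw [hD]
      ring
    · have h : ‖(((G.gdeg v : ℝ) - 1 : ℝ) : ℂ)‖ ≤ M := by
        have h1 : (G.gdeg v : ℝ) ≤ M := by exact_mod_cast hMle v
        have h2 : (0 : ℝ) ≤ G.gdeg v := Nat.cast_nonneg _
        rw [Complex.norm_real, Real.norm_eq_abs, abs_le]
        constructor <;> linarith
      simpa using h
  have hcLoop : ∀ m v, (G.cLoop m v : ℝ) ≤ 2 * a ^ m := by
    intro m v
    have h := (norm_ent_le (C m) v v).trans (hC.norm_le hA hD hfin hAM hQM ha hMa ha1 m)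
    rwa [hC.ent_eq_cLoop hfin, Complex.norm_natCast] at h
  have hRbound : ∀ m, ‖ent (R m) x₀ x‖ ≤ 4 * M * ((m : ℝ) ^ 2 * a ^ m) := by
    intro m
    rcases Nat.lt_or_ge m 3 with hm | hm
    · rw [hR_small m (by omega)]
      simp only [ent, zero_apply, lp.coeFn_zero, Pi.zero_apply, norm_zero]
      positivity
    · rw [ent_of_isDiagonal (hR m hm), norm_mul]
      refine (mul_le_of_le_one_right (norm_nonneg _) ?_).trans
        (G.norm_sum_mul_lapc_le hfin hMle ha1 hcLoop m x₀)
      split_ifs <;> simp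
  have hNX' : ∀ m, NX (m + 1) = logDerivCoeff A (D - 1) m + R (m + 1) := by
    intro m
    rw [hNX]
    match m with
    | 0 =>
      rw [hB_small _ (by omega), hRp_small _ (by omega), hR_small _ (by omega),
        hC.one_eq hA hfin, logDerivCoeff]
    | 1 =>
      rw [hB_small _ (by omega), hRp_small _ (by omega), hR_small _ (by omega),
        ← sub_eq_iff_eq_add.2 (hC.adj_mul_one hA hD hfin)]
      simp only [logDerivCoeff, resolventCoeff, mul_one, two_smul, Even.zero, if_true]
      abel
    | m + 2 =>
      rw [hB _ (by omega), hRp _ (by omega), hC.sum_eq_resolventCoeff hA hD hfin (m + 1),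
        hC.eq_resolventCoeff_sub hA hD hfin (m + 1)]
      have heven : Even (m + 2 + 1) ↔ Even (m + 1) := by simp [Nat.even_add_one]
      simp only [heven, logDerivCoeff]
      rw [show resolventCoeff A (D - 1) (m + 1 + 2) = A * resolventCoeff A (D - 1) (m + 2) -
        (D - 1) * resolventCoeff A (D - 1) (m + 1) from rfl, two_smul]
      noncomm_ring
  have hφQ : entCLM x₀ x (D - 1 - 1) = ((G.gdeg x₀ : ℂ) - 2) * if x = x₀ then 1 else 0 := by
    rw [entCLM_apply]
    refine ent_of_isDiagonal (d := fun v => (G.gdeg v : ℂ) - 2) (fun f v => ?_) x₀ x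
    change D f v - f v - f v = _
    rw [hD]
    ring
  have hsumR := summable_sq_mul_geometric_div (zero_le_one.trans ha1) hua hRbound
  have hsumL := summable_logDerivCoeff_series (entCLM x₀ x) hAM hQM ha hMa ha1 hua
  have hsplit : ∑' m : ℕ, ent (NX (m + 1)) x₀ x / ((m : ℂ) + 1) * u ^ (m + 1) =
      ∑' m : ℕ, entCLM x₀ x (logDerivCoeff A (D - 1) m) / ((m : ℂ) + 1) * u ^ (m + 1) +
        ∑' m : ℕ, ent (R (m + 3)) x₀ x / ((m : ℂ) + 3) * u ^ (m + 3) := by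
    have hR3 : ∑' m : ℕ, ent (R (m + 1)) x₀ x / ((m : ℂ) + 1) * u ^ (m + 1) =
        ∑' m : ℕ, ent (R (m + 3)) x₀ x / ((m : ℂ) + 3) * u ^ (m + 3) := by
      rw [← hsumR.sum_add_tsum_nat_add 2]
      have h0 : ∀ m ≤ 2, ent (R m) x₀ x = 0 := fun m hm => by
        rw [hR_small m hm]
        rfl
      rw [Finset.sum_range_succ, Finset.sum_range_one, h0 _ (by omega), h0 _ (by omega)]
      simp only [zero_div, zero_mul, zero_add]
      refine tsum_congr fun m => ?_
      push_cast
      rw [add_assoc (m : ℂ)]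
      norm_num
    rw [← hR3, ← hsumL.tsum_add hsumR]
    refine tsum_congr fun m => ?_
    rw [hNX', ← entCLM_apply, ← entCLM_apply, map_add]
    ring
  have hu2 : 1 - u ^ 2 ≠ 0 := by
    intro h
    have h1 : ‖u ^ 2‖ = 1 := by rw [← sub_eq_zero.1 h, norm_one]
    rw [norm_pow] at h1
    exact (pow_lt_one₀ (norm_nonneg u) hu1 two_ne_zero).ne h1
  have hlog : -(ent (-(∑' n : ℕ, ((n : ℂ) + 1)⁻¹ •
      (u • (D - (D - A)) - u ^ 2 • (D - 1)) ^ (n + 1))) x₀ x) =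
      entCLM x₀ x (∑' n : ℕ, ((n : ℂ) + 1)⁻¹ • pencil A (D - 1) u ^ (n + 1)) := by
    rw [← entCLM_apply, map_neg, neg_neg, sub_sub_cancel]
    rfl
  have hcomm : A * (D - 1) - (D - 1) * A = A * D - D * A := by noncomm_ring
  have hintegral : ∀ z : ℂ, commutatorIntegrand A (D - 1) (entCLM x₀ x) z =
      z ^ 2 * ∑' n : ℕ, ((n : ℂ) + 1)⁻¹ * ∑ j ∈ Finset.Icc 1 n, (j : ℂ) *
        ent ((z • A - z ^ 2 • (D - 1)) ^ (n - j) * (A * D - D * A) *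
          (z • A - z ^ 2 • (D - 1)) ^ (j - 1)) x₀ x := by
    intro z
    simp only [commutatorIntegrand, commutatorSum, map_sum, map_smul, smul_eq_mul, hcomm,
      entCLM_apply, pencil]
  rw [hsplit, logDerivCoeff_series_eq (entCLM x₀ x) hAM hQM ha hMa ha1 hua, hlog,
    Complex.cpow_def_of_ne_zero hu2, ← Complex.exp_add, ← Complex.exp_add, ← Complex.exp_add,
    hφQ]
  simp only [hintegral]
  congr 4
  ring
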